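/- arXiv:2507.20450 — 3 statements merged into one kernel-verified Lean document; each statement's English description precedes it below -/
import Mathlib

section
/- Let N ≥ 3, f(s) = s^p + s^r with p_c < p < p_* and 0 < r < r^*. Then there exist r₀ > 0, ε > 0 and C > 0 such that for every α, β > 0 with α + β < ε there exists θ ∈ C²((0,r₀)) ∩ C¹((0,r₀]) with θ(r₀) = α and r₀·θ'(r₀) = −β such that u(ρ) := ũ(ρ)(1 + θ(ρ)) is positive on (0,r₀), satisfies u''(ρ) + ((N−1)/ρ)·u'(ρ) + u(ρ)^p + u(ρ)^r = 0 for all ρ ∈ (0,r₀), u(ρ) → ∞ as ρ → 0+, and |θ(ρ)| + ρ·|θ'(ρ)| ≤ C·ρ^{λ₁} for all ρ ∈ (0,r₀), where λ₁ := (2m−N+2−√((N−2−2m)²−8(N−2−m)))/2 with m := 2/(p−1). -/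
/-- The exponent `p_* = 1 + 4/(N−4+2√(N−1))`. -/
noncomputable def pStar (N : ℕ) : ℝ :=
  1 + 4 / ((N : ℝ) - 4 + 2 * Real.sqrt ((N : ℝ) - 1))

/-- `λ₁ = (2m−N+2−√((N−2−2m)²−8(N−2−m)))/2` with `m = 2/(p−1)`. -/
noncomputable def lamOne (N : ℕ) (p : ℝ) : ℝ :=
  (2 * (2 / (p - 1)) - (N : ℝ) + 2 -
    Real.sqrt (((N : ℝ) - 2 - 2 * (2 / (p - 1))) ^ 2 -
      8 * ((N : ℝ) - 2 - 2 / (p - 1)))) / 2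

/-- The exponent `r^*` of (1.16):
`r^* = ((p−1)/4)(N−2−√((N−2−4/(p−1))²−8(N−2−2/(p−1))))` if `p_c < p < p_*`,
`r^* = (p−1)(N−2)/4` if `p_* ≤ p < p_S`. -/
noncomputable def rStar (N : ℕ) (p : ℝ) : ℝ :=
  if p < pStar N then
    ((p - 1) / 4) * ((N : ℝ) - 2 -
      Real.sqrt (((N : ℝ) - 2 - 4 / (p - 1)) ^ 2 -
        8 * ((N : ℝ) - 2 - 2 / (p - 1))))
  else (p - 1) * ((N : ℝ) - 2) / 4

/-- The solution of `y' = -a y + g`, `y 0 = c`, by variation of constants. -/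
noncomputable def duhamelMode (a c : ℝ) (g : ℝ → ℝ) (x : ℝ) : ℝ :=
  Real.exp (-(a * x)) * (c + ∫ s in (0 : ℝ)..x, Real.exp (a * s) * g s)

theorem duhamelMode_zero (a c : ℝ) (g : ℝ → ℝ) : duhamelMode a c g 0 = c := by
  simp [duhamelMode]

theorem hasDerivAt_duhamelMode (a c : ℝ) {g : ℝ → ℝ} (hg : Continuous g) (x : ℝ) :
    HasDerivAt (duhamelMode a c g) (-a * duhamelMode a c g x + g x) x := by
  have hc : Continuous fun s => Real.exp (a * s) * g s := by fun_prop
  have h1 : HasDerivAt (fun x => Real.exp (-(a * x))) (Real.exp (-(a * x)) * (-(a * 1))) x :=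
    ((hasDerivAt_id x).const_mul a).neg.exp
  have h2 := (hc.integral_hasStrictDerivAt 0 x).hasDerivAt.const_add c
  refine (h1.mul h2).congr_deriv ?_
  have h3 : Real.exp (-(a * x)) * Real.exp (a * x) = 1 := by
    rw [← Real.exp_add]; simp
  unfold duhamelMode
  linear_combination g x * h3

theorem duhamelMode_sub (a c : ℝ) {g g' : ℝ → ℝ} (hg : Continuous g) (hg' : Continuous g')
    (x : ℝ) :
    duhamelMode a c g x - duhamelMode a c g' x = duhamelMode a 0 (fun s => g s - g' s) x := by
  have h : (∫ s in (0 : ℝ)..x, Real.exp (a * s) * (g s - g' s)) =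
      (∫ s in (0 : ℝ)..x, Real.exp (a * s) * g s) -
        ∫ s in (0 : ℝ)..x, Real.exp (a * s) * g' s := by
    rw [← intervalIntegral.integral_sub]
    · simp only [mul_sub]
    · exact (Continuous.intervalIntegrable (by fun_prop) _ _)
    · exact (Continuous.intervalIntegrable (by fun_prop) _ _)
  unfold duhamelMode
  rw [h]; ring

theorem integral_exp_neg_mul_le {μ : ℝ} (hμ : 0 < μ) (B : ℝ) (hB : 0 ≤ B) (x : ℝ) :
    (∫ s in (0 : ℝ)..x, B * Real.exp (-(μ * s))) ≤ B / μ := by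
  have hd : ∀ s : ℝ, HasDerivAt (fun s => -(B / μ) * Real.exp (-(μ * s)))
      (B * Real.exp (-(μ * s))) s := by
    intro s
    refine ((((hasDerivAt_id s).const_mul μ).neg.exp).const_mul (-(B / μ))).congr_deriv ?_
    simp only [id, Pi.neg_apply]
    field_simp
  rw [intervalIntegral.integral_eq_sub_of_hasDerivAt (fun s _ => hd s)
    (Continuous.intervalIntegrable (by fun_prop) _ _)]
  have : 0 ≤ B / μ * Real.exp (-(μ * x)) := by positivity
  simp
  linarith

theorem abs_duhamelMode_le {l a μ B c : ℝ} (hla : l ≤ a) (hμ : 0 < μ) (hB : 0 ≤ B)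
    {h : ℝ → ℝ} (hb : ∀ s, 0 ≤ s → |h s| ≤ B * Real.exp (-(μ * s)))
    {x : ℝ} (hx : 0 ≤ x) :
    Real.exp (l * x) * |duhamelMode a c (fun s => Real.exp (-(l * s)) * h s) x| ≤
      |c| + B / μ := by
  have e1 : Real.exp (l * x) * |duhamelMode a c (fun s => Real.exp (-(l * s)) * h s) x| =
      |Real.exp ((l - a) * x) * c + ∫ s in (0 : ℝ)..x, Real.exp ((l - a) * (x - s)) * h s| := by
    have : (∫ s in (0 : ℝ)..x, Real.exp ((l - a) * (x - s)) * h s) =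
        Real.exp ((l - a) * x) *
          ∫ s in (0 : ℝ)..x, Real.exp (a * s) * (Real.exp (-(l * s)) * h s) := by
      rw [← intervalIntegral.integral_const_mul]
      congr 1
      ext s
      rw [← mul_assoc, ← mul_assoc, ← Real.exp_add, ← Real.exp_add]
      ring_nf
    rw [this, ← mul_add, abs_mul, abs_of_pos (Real.exp_pos _), duhamelMode, abs_mul,
      abs_of_pos (Real.exp_pos _), ← mul_assoc, ← Real.exp_add]
    ring_nf
  rw [e1]
  have e2 : |∫ s in (0 : ℝ)..x, Real.exp ((l - a) * (x - s)) * h s| ≤ B / μ := by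
    refine le_trans ?_ (integral_exp_neg_mul_le hμ B hB x)
    rw [← Real.norm_eq_abs]
    refine intervalIntegral.norm_integral_le_of_norm_le hx ?_
      (Continuous.intervalIntegrable (by fun_prop) _ _)
    refine Filter.Eventually.of_forall fun s hs => ?_
    rw [Real.norm_eq_abs, abs_mul, abs_of_pos (Real.exp_pos _)]
    have : Real.exp ((l - a) * (x - s)) ≤ 1 :=
      Real.exp_le_one_iff.2 (mul_nonpos_of_nonpos_of_nonneg (by linarith) (by linarith [hs.2]))
    calc _ ≤ 1 * |h s| := by gcongr
      _ ≤ _ := by rw [one_mul]; exact hb s hs.1.le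
  have e3 : |Real.exp ((l - a) * x) * c| ≤ |c| := by
    rw [abs_mul, abs_of_pos (Real.exp_pos _)]
    have : Real.exp ((l - a) * x) ≤ 1 :=
      Real.exp_le_one_iff.2 (mul_nonpos_of_nonpos_of_nonneg (by linarith) hx)
    calc _ ≤ 1 * |c| := by gcongr
      _ = _ := one_mul _
  exact (abs_add_le _ _).trans (add_le_add e3 e2)

/-- The pair `(φ, φ')`, where `φ'' + (l₁ + l₂) φ' + l₁ l₂ φ = exp (-l₁ x) h` with initial data
`φ 0 = φ₀`, `φ' 0 = ψ₀`. -/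
noncomputable def linearFlow (l₁ l₂ φ₀ ψ₀ : ℝ) (h : ℝ → ℝ) (x : ℝ) : ℝ × ℝ :=
  let g := fun s => Real.exp (-(l₁ * s)) * h s
  let y₁ := duhamelMode l₁ (ψ₀ + l₂ * φ₀) g x
  let y₂ := duhamelMode l₂ (ψ₀ + l₁ * φ₀) g x
  ((y₁ - y₂) / (l₂ - l₁), (l₂ * y₂ - l₁ * y₁) / (l₂ - l₁))

section LinearFlow

variable {l₁ l₂ φ₀ ψ₀ : ℝ} {h h' : ℝ → ℝ}

theorem linearFlow_zero (hl : l₁ < l₂) : linearFlow l₁ l₂ φ₀ ψ₀ h 0 = (φ₀, ψ₀) := by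
  have : l₂ - l₁ ≠ 0 := by linarith
  simp only [linearFlow, duhamelMode_zero, Prod.mk.injEq]
  constructor <;> field_simp <;> ring

theorem hasDerivAt_linearFlow_fst (hl : l₁ < l₂) (hh : Continuous h) (x : ℝ) :
    HasDerivAt (fun x => (linearFlow l₁ l₂ φ₀ ψ₀ h x).1) (linearFlow l₁ l₂ φ₀ ψ₀ h x).2 x := by
  have : l₂ - l₁ ≠ 0 := by linarith
  have hg : Continuous fun s => Real.exp (-(l₁ * s)) * h s := by fun_prop
  refine (((hasDerivAt_duhamelMode l₁ (ψ₀ + l₂ * φ₀) hg x).sub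
    (hasDerivAt_duhamelMode l₂ (ψ₀ + l₁ * φ₀) hg x)).div_const (l₂ - l₁)).congr_deriv ?_
  simp only [linearFlow]
  field_simp
  ring

theorem hasDerivAt_linearFlow_snd (hl : l₁ < l₂) (hh : Continuous h) (x : ℝ) :
    HasDerivAt (fun x => (linearFlow l₁ l₂ φ₀ ψ₀ h x).2)
      (-(l₁ + l₂) * (linearFlow l₁ l₂ φ₀ ψ₀ h x).2
        - l₁ * l₂ * (linearFlow l₁ l₂ φ₀ ψ₀ h x).1 + Real.exp (-(l₁ * x)) * h x) x := by
  have : l₂ - l₁ ≠ 0 := by linarith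
  have hg : Continuous fun s => Real.exp (-(l₁ * s)) * h s := by fun_prop
  refine ((((hasDerivAt_duhamelMode l₂ (ψ₀ + l₁ * φ₀) hg x).const_mul l₂).sub
    ((hasDerivAt_duhamelMode l₁ (ψ₀ + l₂ * φ₀) hg x).const_mul l₁)).div_const
      (l₂ - l₁)).congr_deriv ?_
  simp only [linearFlow]
  field_simp
  ring

theorem continuous_linearFlow (hl : l₁ < l₂) (hh : Continuous h) :
    Continuous (linearFlow l₁ l₂ φ₀ ψ₀ h) :=
  (continuous_iff_continuousAt.2 fun x =>
    (hasDerivAt_linearFlow_fst hl hh x).continuousAt).prodMk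
  (continuous_iff_continuousAt.2 fun x =>
    (hasDerivAt_linearFlow_snd hl hh x).continuousAt)

theorem linearFlow_sub (hh : Continuous h) (hh' : Continuous h') (x : ℝ) :
    linearFlow l₁ l₂ φ₀ ψ₀ h x - linearFlow l₁ l₂ φ₀ ψ₀ h' x =
      linearFlow l₁ l₂ 0 0 (fun s => h s - h' s) x := by
  have hg : Continuous fun s => Real.exp (-(l₁ * s)) * h s := by fun_prop
  have hg' : Continuous fun s => Real.exp (-(l₁ * s)) * h' s := by fun_prop
  have h1 := duhamelMode_sub l₁ (ψ₀ + l₂ * φ₀) hg hg' x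
  have h2 := duhamelMode_sub l₂ (ψ₀ + l₁ * φ₀) hg hg' x
  simp only [linearFlow, Prod.mk_sub_mk, mul_zero, add_zero, mul_sub, Prod.mk.injEq] at h1 h2 ⊢
  rw [← h1, ← h2]
  constructor <;> ring

theorem norm_linearFlow_le {μ B : ℝ} (hl₁ : 0 < l₁) (hl : l₁ < l₂) (hμ : 0 < μ) (hB : 0 ≤ B)
    (hb : ∀ s, 0 ≤ s → |h s| ≤ B * Real.exp (-(μ * s))) {x : ℝ} (hx : 0 ≤ x) :
    ‖Real.exp (l₁ * x) • linearFlow l₁ l₂ φ₀ ψ₀ h x‖ ≤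
      (2 + l₁ + l₂) * (1 + l₂) / (l₂ - l₁) * (|φ₀| + |ψ₀| + B / μ) := by
  have hk : 0 < l₂ - l₁ := by linarith
  have hl₂ : 0 < l₂ := by linarith
  set D := (1 + l₂) * (|φ₀| + |ψ₀| + B / μ) with hD
  have hBμ : 0 ≤ B / μ := by positivity
  have b1 := abs_duhamelMode_le (c := ψ₀ + l₂ * φ₀) le_rfl hμ hB hb hx (l := l₁)
  have b2 := abs_duhamelMode_le (c := ψ₀ + l₁ * φ₀) hl.le hμ hB hb hx (l := l₁)
  have c1 : |ψ₀ + l₂ * φ₀| + B / μ ≤ D := by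
    have : |ψ₀ + l₂ * φ₀| ≤ |ψ₀| + l₂ * |φ₀| := by
      refine (abs_add_le _ _).trans ?_
      rw [abs_mul, abs_of_pos hl₂]
    nlinarith [abs_nonneg φ₀, abs_nonneg ψ₀]
  have c2 : |ψ₀ + l₁ * φ₀| + B / μ ≤ D := by
    have : |ψ₀ + l₁ * φ₀| ≤ |ψ₀| + l₁ * |φ₀| := by
      refine (abs_add_le _ _).trans ?_
      rw [abs_mul, abs_of_pos hl₁]
    nlinarith [abs_nonneg φ₀, abs_nonneg ψ₀]
  have b1 := b1.trans c1
  have b2 := b2.trans c2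
  have hD0 : 0 ≤ D := by positivity
  rw [show (2 + l₁ + l₂) * (1 + l₂) / (l₂ - l₁) * (|φ₀| + |ψ₀| + B / μ) =
    (2 + l₁ + l₂) * D / (l₂ - l₁) by rw [hD]; ring]
  rw [norm_smul, Real.norm_of_nonneg (Real.exp_pos _).le]
  set E := Real.exp (l₁ * x)
  have hE : 0 < E := Real.exp_pos _
  simp only [linearFlow]
  set y₁ := duhamelMode l₁ (ψ₀ + l₂ * φ₀) (fun s => Real.exp (-(l₁ * s)) * h s) x
  set y₂ := duhamelMode l₂ (ψ₀ + l₁ * φ₀) (fun s => Real.exp (-(l₁ * s)) * h s) x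
  rw [Prod.norm_mk, mul_max_of_nonneg _ _ hE.le, Real.norm_eq_abs, Real.norm_eq_abs, abs_div,
    abs_div, abs_of_pos hk, ← mul_div_assoc, ← mul_div_assoc]
  refine max_le ?_ ?_
  · refine div_le_div_of_nonneg_right ?_ hk.le
    have : E * |y₁ - y₂| ≤ E * (|y₁| + |y₂|) := by gcongr; exact abs_sub _ _
    nlinarith
  · refine div_le_div_of_nonneg_right ?_ hk.le
    have : E * |l₂ * y₂ - l₁ * y₁| ≤ E * (l₂ * |y₂| + l₁ * |y₁|) := by
      gcongr
      refine (abs_sub _ _).trans ?_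
      rw [abs_mul, abs_mul, abs_of_pos hl₁, abs_of_pos hl₂]
    nlinarith

end LinearFlow

/-- Small decaying solutions of `φ'' + (l₁ + l₂) φ' + l₁ l₂ φ = exp (-l₁ x) H(x, exp (l₁ x) (φ, φ'))` on
`[0, ∞)`, obtained from the contraction principle. -/
theorem exists_decaying_solution {l₁ l₂ μ L η M φ₀ ψ₀ : ℝ} (hl₁ : 0 < l₁) (hl : l₁ < l₂)
    (hμ : 0 < μ) (hL : 0 ≤ L) (hη : 0 ≤ η)
    (hM : M = (2 + l₁ + l₂) * (1 + l₂) / (l₂ - l₁)) (hcontr : M * (L / μ) ≤ 1 / 2)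
    {H : ℝ → ℝ × ℝ → ℝ} (hHc : Continuous fun q : ℝ × (ℝ × ℝ) => H q.1 q.2)
    (hH0 : ∀ s, 0 ≤ s → |H s 0| ≤ η * Real.exp (-(μ * s)))
    (hHL : ∀ s, 0 ≤ s → ∀ z w, |H s z - H s w| ≤ L * ‖z - w‖ * Real.exp (-(μ * s))) :
    ∃ φ ψ g : ℝ → ℝ, Continuous g ∧
      (∀ x, HasDerivAt φ (ψ x) x) ∧
      (∀ x, HasDerivAt ψ (-(l₁ + l₂) * ψ x - l₁ * l₂ * φ x + g x) x) ∧
      (∀ x, 0 ≤ x → g x = Real.exp (-(l₁ * x)) *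
        H x (Real.exp (l₁ * x) * φ x, Real.exp (l₁ * x) * ψ x)) ∧
      φ 0 = φ₀ ∧ ψ 0 = ψ₀ ∧
      ∀ x, 0 ≤ x → |Real.exp (l₁ * x) * φ x| ≤ 2 * M * (|φ₀| + |ψ₀| + η / μ) ∧
        |Real.exp (l₁ * x) * ψ x| ≤ 2 * M * (|φ₀| + |ψ₀| + η / μ) := by
  have hMpos : 0 < M := by
    rw [hM]; have : 0 < l₂ - l₁ := by linarith
    have : 0 < l₂ := by linarith
    positivity
  have hcont : ∀ z : BoundedContinuousFunction ℝ (ℝ × ℝ), Continuous fun s => H s (z s) :=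
    fun z => hHc.comp (continuous_id.prodMk z.continuous)
  have hgrow : ∀ z : BoundedContinuousFunction ℝ (ℝ × ℝ), ∀ s, 0 ≤ s →
      |H s (z s)| ≤ (L * ‖z‖ + η) * Real.exp (-(μ * s)) := by
    intro z s hs
    have h1 := hHL s hs (z s) 0
    have h2 := hH0 s hs
    have h3 : L * ‖z s - 0‖ * Real.exp (-(μ * s)) ≤ L * ‖z‖ * Real.exp (-(μ * s)) := by
      rw [sub_zero]
      gcongr
      exact z.norm_coe_le_norm s
    have h4 : |H s (z s)| ≤ |H s (z s) - H s 0| + |H s 0| := by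
      simpa using abs_add_le (H s (z s) - H s 0) (H s 0)
    linarith
  let U : BoundedContinuousFunction ℝ (ℝ × ℝ) → ℝ → ℝ × ℝ := fun z x =>
    Real.exp (l₁ * x) • linearFlow l₁ l₂ φ₀ ψ₀ (fun s => H s (z s)) x
  have hUbound : ∀ z x, 0 ≤ x → ‖U z x‖ ≤ M * (|φ₀| + |ψ₀| + (L * ‖z‖ + η) / μ) := by
    intro z x hx
    rw [hM]
    exact norm_linearFlow_le hl₁ hl hμ (by positivity) (hgrow z) hx
  have hUcont : ∀ z, Continuous (U z) := fun z =>
    (by fun_prop : Continuous fun x => Real.exp (l₁ * x)).smul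
      (continuous_linearFlow hl (hcont z))
  let T : BoundedContinuousFunction ℝ (ℝ × ℝ) → BoundedContinuousFunction ℝ (ℝ × ℝ) := fun z =>
    BoundedContinuousFunction.ofNormedAddCommGroup (fun x => U z (max 0 x))
      ((hUcont z).comp (by fun_prop)) (M * (|φ₀| + |ψ₀| + (L * ‖z‖ + η) / μ))
      (fun x => hUbound z _ (le_max_left _ _))
  have hT : ∀ z x, T z x = U z (max 0 x) := fun z x => rfl
  have hTc : ContractingWith (1 / 2) T := by
    refine ⟨?_, LipschitzWith.of_dist_le_mul fun z w => ?_⟩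
    · rw [← NNReal.coe_lt_coe]; norm_num
    · rw [BoundedContinuousFunction.dist_le (by positivity)]
      intro x
      rw [dist_eq_norm, hT, hT]
      have hx : 0 ≤ max 0 x := le_max_left _ _
      have e : U z (max 0 x) - U w (max 0 x) = Real.exp (l₁ * max 0 x) •
          linearFlow l₁ l₂ 0 0 (fun s => H s (z s) - H s (w s)) (max 0 x) := by
        simp only [U]
        rw [← smul_sub, linearFlow_sub (hcont z) (hcont w)]
      have hb : ∀ s, 0 ≤ s → |H s (z s) - H s (w s)| ≤ L * dist z w * Real.exp (-(μ * s)) := by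
        intro s hs
        refine (hHL s hs _ _).trans ?_
        gcongr
        rw [← dist_eq_norm]
        exact BoundedContinuousFunction.dist_coe_le_dist s
      rw [e]
      refine (norm_linearFlow_le hl₁ hl hμ (by positivity) hb hx).trans ?_
      rw [← hM]
      have : M * (|(0 : ℝ)| + |(0 : ℝ)| + L * dist z w / μ) = M * (L / μ) * dist z w := by
        rw [abs_zero]; ring
      rw [this]
      push_cast
      exact mul_le_mul_of_nonneg_right hcontr dist_nonneg
  obtain ⟨z, hz⟩ : ∃ z, T z = z := ⟨_, hTc.fixedPoint_isFixedPt⟩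
  have hznorm : ‖z‖ ≤ 2 * M * (|φ₀| + |ψ₀| + η / μ) := by
    have h1 : ‖T z‖ ≤ M * (|φ₀| + |ψ₀| + (L * ‖z‖ + η) / μ) :=
      (BoundedContinuousFunction.norm_le (by positivity)).2
        fun x => hUbound z _ (le_max_left _ _)
    rw [hz] at h1
    have h2 : M * (|φ₀| + |ψ₀| + (L * ‖z‖ + η) / μ) =
      M * (|φ₀| + |ψ₀| + η / μ) + M * (L / μ) * ‖z‖ := by ring
    have h3 := mul_le_mul_of_nonneg_right hcontr (norm_nonneg z)
    linarith
  have hzx : ∀ x, 0 ≤ x → z x =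
      (Real.exp (l₁ * x) * (linearFlow l₁ l₂ φ₀ ψ₀ (fun s => H s (z s)) x).1,
      Real.exp (l₁ * x) * (linearFlow l₁ l₂ φ₀ ψ₀ (fun s => H s (z s)) x).2) := by
    intro x hx
    conv_lhs => rw [← hz, hT, max_eq_right hx]
    rfl
  refine ⟨fun x => (linearFlow l₁ l₂ φ₀ ψ₀ (fun s => H s (z s)) x).1,
    fun x => (linearFlow l₁ l₂ φ₀ ψ₀ (fun s => H s (z s)) x).2,
    fun x => Real.exp (-(l₁ * x)) * H x (z x), ?_, hasDerivAt_linearFlow_fst hl (hcont z),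
    hasDerivAt_linearFlow_snd hl (hcont z), ?_, ?_, ?_, ?_⟩
  · have := hcont z
    fun_prop
  · intro x hx
    simp only
    rw [← hzx x hx]
  · simp only [linearFlow_zero hl]
  · simp only [linearFlow_zero hl]
  · intro x hx
    have h1 := (z.norm_coe_le_norm x).trans hznorm
    rw [hzx x hx, Prod.norm_mk] at h1
    exact ⟨(le_max_left _ _).trans h1, (le_max_right _ _).trans h1⟩

theorem exists_one_add_rpow_lipschitz (q : ℝ) : ∃ L : ℝ, 0 ≤ L ∧ ∀ x y : ℝ, |x| ≤ 1 / 2 →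
    |y| ≤ 1 / 2 → |(1 + x) ^ q - (1 + y) ^ q| ≤ L * |x - y| := by
  have hne : ∀ x ∈ Set.Icc (-(1 / 2) : ℝ) (1 / 2), 1 + x ≠ 0 := fun x hx => by
    have := hx.1
    intro h
    linarith
  have hc : ContinuousOn (fun x : ℝ => q * (1 + x) ^ (q - 1)) (Set.Icc (-(1 / 2)) (1 / 2)) :=
    continuousOn_const.mul ((continuousOn_const.add continuousOn_id).rpow_const
      fun x hx => Or.inl (hne x hx))
  obtain ⟨L, hL⟩ := isCompact_Icc.exists_bound_of_continuousOn hc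
  have hL0 : 0 ≤ L := (norm_nonneg _).trans (hL 0 (by norm_num))
  refine ⟨L, hL0, fun x y hx hy => ?_⟩
  refine Convex.norm_image_sub_le_of_norm_hasDerivWithin_le (f := fun x : ℝ => (1 + x) ^ q)
    (f' := fun x => q * (1 + x) ^ (q - 1)) (s := Set.Icc (-(1 / 2)) (1 / 2))
    (fun z hz => ?_) hL (convex_Icc _ _) (abs_le.1 hy) (abs_le.1 hx)
  have h1 : HasDerivAt (fun x : ℝ => 1 + x) 1 z := (hasDerivAt_id z).const_add 1
  exact ((h1.rpow_const (p := q) (Or.inl (hne z hz))).congr_deriv (by ring)).hasDerivWithinAt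

theorem exists_one_add_rpow_taylor_lipschitz (q : ℝ) : ∃ L : ℝ, 0 ≤ L ∧ ∀ m x y : ℝ,
    m ≤ 1 / 2 → |x| ≤ m → |y| ≤ m →
    |((1 + x) ^ q - 1 - q * x) - ((1 + y) ^ q - 1 - q * y)| ≤ L * m * |x - y| := by
  obtain ⟨L, hL0, hL⟩ := exists_one_add_rpow_lipschitz (q - 1)
  refine ⟨|q| * L, by positivity, fun m x y hm hx hy => ?_⟩
  refine Convex.norm_image_sub_le_of_norm_hasDerivWithin_le
    (f := fun x : ℝ => (1 + x) ^ q - 1 - q * x)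
    (f' := fun x => q * ((1 + x) ^ (q - 1) - 1)) (s := Set.Icc (-m) m)
    (fun z hz => ?_) (fun z hz => ?_) (convex_Icc _ _) (abs_le.1 hy) (abs_le.1 hx)
  · have hz0 : 1 + z ≠ 0 := by
      have := hz.1
      intro h
      linarith
    have h1 : HasDerivAt (fun x : ℝ => 1 + x) 1 z := (hasDerivAt_id z).const_add 1
    exact ((((h1.rpow_const (p := q) (Or.inl hz0)).sub_const 1).sub
      ((hasDerivAt_id z).const_mul q)).congr_deriv (by ring)).hasDerivWithinAt
  · have hz' : |z| ≤ m := abs_le.2 hz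
    have := hL z 0 (hz'.trans hm) (by norm_num)
    rw [add_zero, Real.one_rpow, sub_zero] at this
    rw [norm_mul, Real.norm_eq_abs, Real.norm_eq_abs, mul_assoc]
    gcongr
    exact this.trans (by gcongr)

/-- The remainder after extracting the constant-coefficient linear part from the equation
satisfied by the relative perturbation `φ` in the variable `x = log (r₀ / ρ)`; here
`1 / (p - 1) + a = f(ũ) F(ũ) / ũ` and `w = ũ ^ r / f(ũ)`. -/
noncomputable def perturbRemainder (p r b a w φ ψ : ℝ) : ℝ :=
  -(4 * a * ψ) - b * a * ((1 + φ) ^ p - (1 + φ))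
    - 4 * (1 / (p - 1) + a) * (p * a - (p - r) * (1 / (p - 1) + a) * w) * (1 + φ)
    - b * (1 / (p - 1) + a) * w * ((1 + φ) ^ r - (1 + φ) ^ p)
    - b / (p - 1) * ((1 + φ) ^ p - 1 - p * φ)

theorem exists_perturbRemainder_bound (p r b : ℝ) : ∃ K : ℝ, 0 ≤ K ∧ ∀ a w κ : ℝ,
    |a| ≤ κ → |w| ≤ κ → κ ≤ 1 →
    |perturbRemainder p r b a w 0 0| ≤ K * κ ∧
    ∀ m d φ ψ φ' ψ' : ℝ, m ≤ 1 / 2 → |φ| ≤ m → |φ'| ≤ m → |φ - φ'| ≤ d → |ψ - ψ'| ≤ d →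
      |perturbRemainder p r b a w φ ψ - perturbRemainder p r b a w φ' ψ'| ≤
        K * (κ + m) * d := by
  obtain ⟨Lp, hLp0, hLp⟩ := exists_one_add_rpow_lipschitz p
  obtain ⟨Lr, hLr0, hLr⟩ := exists_one_add_rpow_lipschitz r
  obtain ⟨Lq, hLq0, hLq⟩ := exists_one_add_rpow_taylor_lipschitz p
  set A₀ := |1 / (p - 1)| + 1 with hA₀
  set K₃ := 4 * A₀ * (|p| + |p - r| * A₀) with hK₃
  set K₁ := 4 + |b| * (Lp + 1) + K₃ + |b| * A₀ * (Lp + Lr) with hK₁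
  set K₂ := |b / (p - 1)| * Lq with hK₂
  have hA₀0 : 0 ≤ A₀ := by positivity
  have hK₃0 : 0 ≤ K₃ := by positivity
  have hK₂0 : 0 ≤ K₂ := by positivity
  have hK₁0 : 0 ≤ K₁ := by positivity
  have hK₃₁ : K₃ ≤ K₁ := by
    have : 0 ≤ 4 + |b| * (Lp + 1) + |b| * A₀ * (Lp + Lr) := by positivity
    linarith
  refine ⟨K₁ + K₂, by positivity, fun a w κ ha hw hκ => ?_⟩
  have hκ0 : 0 ≤ κ := (abs_nonneg a).trans ha
  have hA : |1 / (p - 1) + a| ≤ A₀ := (abs_add_le _ _).trans (by rw [hA₀]; linarith)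
  set A := 1 / (p - 1) + a with hAdef
  set c₃ := 4 * A * (p * a - (p - r) * A * w) with hc₃
  have hc₃b : |c₃| ≤ K₃ * κ := by
    have h1 : |p * a - (p - r) * A * w| ≤ |p| * κ + |p - r| * A₀ * κ := by
      refine (abs_sub _ _).trans ?_
      rw [abs_mul, abs_mul, abs_mul]
      gcongr
    calc |c₃| = 4 * |A| * |p * a - (p - r) * A * w| := by
          rw [hc₃, abs_mul, abs_mul]; norm_num
      _ ≤ 4 * A₀ * (|p| * κ + |p - r| * A₀ * κ) := by gcongr
      _ = K₃ * κ := by rw [hK₃]; ring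
  constructor
  · have : perturbRemainder p r b a w 0 0 = -c₃ := by
      simp [perturbRemainder, hc₃, hAdef]
    rw [this, abs_neg]
    have : 0 ≤ K₂ * κ := by positivity
    nlinarith
  · intro m d φ ψ φ' ψ' hm hφ hφ' hd hd'
    have hm0 : 0 ≤ m := (abs_nonneg φ).trans hφ
    have hd0 : 0 ≤ d := (abs_nonneg _).trans hd
    have e : perturbRemainder p r b a w φ ψ - perturbRemainder p r b a w φ' ψ' =
        -(4 * a) * (ψ - ψ') + (-(b * a)) * (((1 + φ) ^ p - (1 + φ') ^ p) - (φ - φ'))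
        + (-c₃) * (φ - φ')
        + (-(b * A * w)) * (((1 + φ) ^ r - (1 + φ') ^ r) - ((1 + φ) ^ p - (1 + φ') ^ p))
        + (-(b / (p - 1))) * (((1 + φ) ^ p - 1 - p * φ) - ((1 + φ') ^ p - 1 - p * φ')) := by
      simp only [perturbRemainder, hc₃, hAdef]
      ring
    have hP := (hLp φ φ' (hφ.trans hm) (hφ'.trans hm)).trans (mul_le_mul_of_nonneg_left hd hLp0)
    have hRr := (hLr φ φ' (hφ.trans hm) (hφ'.trans hm)).trans (mul_le_mul_of_nonneg_left hd hLr0)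
    have hQ := (hLq m φ φ' hm hφ hφ').trans (mul_le_mul_of_nonneg_left hd (by positivity))
    have t1 : |-(4 * a) * (ψ - ψ')| ≤ 4 * κ * d := by
      rw [abs_mul, abs_neg, abs_mul]
      norm_num
      gcongr
    have t2 : |-(b * a) * (((1 + φ) ^ p - (1 + φ') ^ p) - (φ - φ'))| ≤
        |b| * κ * (Lp * d + d) := by
      rw [abs_mul, abs_neg, abs_mul]
      gcongr
      exact (abs_sub _ _).trans (add_le_add hP hd)
    have t3 : |-c₃ * (φ - φ')| ≤ K₃ * κ * d := by
      rw [abs_mul, abs_neg]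
      gcongr
    have t4 : |-(b * A * w) * (((1 + φ) ^ r - (1 + φ') ^ r) - ((1 + φ) ^ p - (1 + φ') ^ p))| ≤
        |b| * A₀ * κ * (Lr * d + Lp * d) := by
      rw [abs_mul, abs_neg, abs_mul, abs_mul]
      gcongr
      exact (abs_sub _ _).trans (add_le_add hRr hP)
    have t5 : |-(b / (p - 1)) * (((1 + φ) ^ p - 1 - p * φ) - ((1 + φ') ^ p - 1 - p * φ'))| ≤
        |b / (p - 1)| * (Lq * m * d) := by
      rw [abs_mul, abs_neg]
      gcongr
    rw [e]
    refine (abs_add_le _ _).trans ?_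
    refine (add_le_add_left ((abs_add_le _ _).trans (add_le_add_left ((abs_add_le _ _).trans
      (add_le_add_left (abs_add_le _ _) _)) _)) _).trans ?_
    have e2 : (K₁ + K₂) * (κ + m) * d = 4 * κ * d + |b| * κ * (Lp * d + d) + K₃ * κ * d +
        |b| * A₀ * κ * (Lr * d + Lp * d) + |b / (p - 1)| * (Lq * m * d) +
        (K₁ * m * d + K₂ * κ * d) := by
      rw [hK₁, hK₂]; ring
    have : 0 ≤ K₁ * m * d + K₂ * κ * d := by positivity
    linarith

theorem continuous_perturbRemainder {p r : ℝ} (hp : 0 ≤ p) (hr : 0 ≤ r) (b : ℝ)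
    {X : Type*} [TopologicalSpace X] {a w φ ψ : X → ℝ} (ha : Continuous a) (hw : Continuous w)
    (hφ : Continuous φ) (hψ : Continuous ψ) :
    Continuous fun x => perturbRemainder p r b (a x) (w x) (φ x) (ψ x) := by
  have h1 : Continuous fun x => (1 + φ x) ^ p := (continuous_const.add hφ).rpow_const
    fun _ => Or.inr hp
  have h2 : Continuous fun x => (1 + φ x) ^ r := (continuous_const.add hφ).rpow_const
    fun _ => Or.inr hr
  unfold perturbRemainder
  fun_prop

theorem abs_clamp_sub_clamp_le (R x y : ℝ) :
    |max (-R) (min R x) - max (-R) (min R y)| ≤ |x - y| := by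
  have h1 := abs_max_sub_max_le_max (-R) (min R x) (-R) (min R y)
  have h2 := abs_min_sub_min_le_max R x R y
  exact h1.trans (max_le (by simp) (h2.trans (max_le (by simp) le_rfl)))

/-- Small decaying solutions of the perturbation equation in the variable
`x = log (r₀ / ρ) ∈ [0, ∞)`, when the coefficients are exponentially close to their limits. -/
theorem exists_perturbation {p r b l₁ l₂ δ : ℝ} (hp : 0 ≤ p) (hr : 0 ≤ r) (hl₁ : 0 < l₁)
    (hl : l₁ < l₂) (hδ : l₁ < δ) :
    ∃ κ ε : ℝ, 0 < κ ∧ 0 < ε ∧ ∀ a w : ℝ → ℝ, Continuous a → Continuous w →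
      (∀ x, 0 ≤ x → |a x| ≤ κ * Real.exp (-(δ * x))) →
      (∀ x, 0 ≤ x → |w x| ≤ κ * Real.exp (-(δ * x))) →
      ∀ φ₀ ψ₀ : ℝ, |φ₀| + |ψ₀| < ε → ∃ φ ψ g : ℝ → ℝ, Continuous g ∧
        (∀ x, HasDerivAt φ (ψ x) x) ∧
        (∀ x, HasDerivAt ψ (-(l₁ + l₂) * ψ x - l₁ * l₂ * φ x + g x) x) ∧
        (∀ x, 0 ≤ x → g x = perturbRemainder p r b (a x) (w x) (φ x) (ψ x)) ∧
        φ 0 = φ₀ ∧ ψ 0 = ψ₀ ∧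
        ∀ x, 0 ≤ x → |φ x| ≤ Real.exp (-(l₁ * x)) / 2 ∧ |ψ x| ≤ Real.exp (-(l₁ * x)) / 2 := by
  obtain ⟨K, hK0, hK⟩ := exists_perturbRemainder_bound p r b
  set M := (2 + l₁ + l₂) * (1 + l₂) / (l₂ - l₁) with hM
  have hMpos : 0 < M := by
    have : 0 < l₂ - l₁ := by linarith
    have : 0 < l₂ := by linarith
    positivity
  obtain ⟨μ, hμ, hμl, hμδ⟩ : ∃ μ, 0 < μ ∧ μ ≤ l₁ ∧ μ ≤ δ - l₁ :=
    ⟨min l₁ (δ - l₁), lt_min hl₁ (by linarith), min_le_left _ _, min_le_right _ _⟩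
  set R := min (1 / 2) (μ / (4 * (M * K + 1))) with hR
  have hRpos : 0 < R := lt_min (by norm_num) (by positivity)
  have hR2 : R ≤ 1 / 2 := min_le_left _ _
  have hMK : 0 ≤ M * K := by positivity
  have hR3 : R * (4 * (M * K + 1)) ≤ μ := by
    rw [← le_div_iff₀ (by positivity)]; exact min_le_right _ _
  set κ := min R (R * μ / (4 * (M * K + 1))) with hκ
  have hκpos : 0 < κ := lt_min hRpos (by positivity)
  have hκR : κ ≤ R := min_le_left _ _
  have hκ3 : κ * (4 * (M * K + 1)) ≤ R * μ := by
    rw [← le_div_iff₀ (by positivity)]; exact min_le_right _ _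
  refine ⟨κ, R / (4 * M), hκpos, by positivity, fun a w hac hwc ha hw φ₀ ψ₀ hε => ?_⟩
  have hκexp : ∀ x, 0 ≤ x → κ * Real.exp (-(δ * x)) ≤ 1 := by
    intro x hx
    have : Real.exp (-(δ * x)) ≤ 1 := Real.exp_le_one_iff.2 (by nlinarith)
    nlinarith
  let H : ℝ → ℝ × ℝ → ℝ := fun x z => Real.exp (l₁ * x) *
    perturbRemainder p r b (a x) (w x) (Real.exp (-(l₁ * x)) * max (-R) (min R z.1))
      (Real.exp (-(l₁ * x)) * max (-R) (min R z.2))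
  have hHc : Continuous fun q : ℝ × (ℝ × ℝ) => H q.1 q.2 := by
    have := continuous_perturbRemainder hp hr b (X := ℝ × (ℝ × ℝ)) (hac.comp continuous_fst)
      (hwc.comp continuous_fst)
      (φ := fun q => Real.exp (-(l₁ * q.1)) * max (-R) (min R q.2.1))
      (ψ := fun q => Real.exp (-(l₁ * q.1)) * max (-R) (min R q.2.2))
      (by fun_prop) (by fun_prop)
    simp only [Function.comp_def] at this
    simp only [H]
    fun_prop
  have hcl : ∀ x : ℝ, |max (-R) (min R x)| ≤ R := fun x =>
    abs_le.2 ⟨le_max_left _ _, max_le (by linarith) (min_le_left _ _)⟩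
  have hH0 : ∀ x, 0 ≤ x → |H x 0| ≤ K * κ * Real.exp (-(μ * x)) := by
    intro x hx
    have h0 : max (-R) (min R (0 : ℝ)) = 0 := by
      rw [min_eq_right hRpos.le, max_eq_right (by linarith)]
    simp only [H, Prod.fst_zero, Prod.snd_zero, h0, mul_zero]
    rw [abs_mul, abs_of_pos (Real.exp_pos _)]
    have h1 := (hK _ _ _ (ha x hx) (hw x hx) (hκexp x hx)).1
    calc _ ≤ Real.exp (l₁ * x) * (K * (κ * Real.exp (-(δ * x)))) := by gcongr
      _ = K * κ * Real.exp (l₁ * x + -(δ * x)) := by rw [Real.exp_add]; ring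
      _ ≤ _ := by
        gcongr
        nlinarith
  have hHL : ∀ x, 0 ≤ x → ∀ z v, |H x z - H x v| ≤
      (K * (κ + R)) * ‖z - v‖ * Real.exp (-(μ * x)) := by
    intro x hx z v
    set e := Real.exp (-(l₁ * x)) with he
    have he0 : 0 < e := Real.exp_pos _
    have hee : Real.exp (l₁ * x) * e = 1 := by rw [he, ← Real.exp_add]; simp
    have heμ : e ≤ Real.exp (-(μ * x)) := by rw [he]; gcongr
    have hδμ : Real.exp (-(δ * x)) ≤ Real.exp (-(μ * x)) := by
      gcongr; linarith
    have he1 : e ≤ 1 := Real.exp_le_one_iff.2 (by nlinarith)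
    have hz1 : |z.1 - v.1| ≤ ‖z - v‖ := norm_fst_le (z - v)
    have hz2 : |z.2 - v.2| ≤ ‖z - v‖ := norm_snd_le (z - v)
    have key := (hK _ _ _ (ha x hx) (hw x hx) (hκexp x hx)).2 (e * R) (e * ‖z - v‖)
      (e * max (-R) (min R z.1)) (e * max (-R) (min R z.2))
      (e * max (-R) (min R v.1)) (e * max (-R) (min R v.2)) (by nlinarith)
      (by rw [abs_mul, abs_of_pos he0]; gcongr; exact hcl _)
      (by rw [abs_mul, abs_of_pos he0]; gcongr; exact hcl _)
      (by rw [← mul_sub, abs_mul, abs_of_pos he0]; gcongr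
          exact (abs_clamp_sub_clamp_le _ _ _).trans hz1)
      (by rw [← mul_sub, abs_mul, abs_of_pos he0]; gcongr
          exact (abs_clamp_sub_clamp_le _ _ _).trans hz2)
    simp only [H]
    rw [← mul_sub, abs_mul, abs_of_pos (Real.exp_pos _)]
    calc _ ≤ Real.exp (l₁ * x) *
          (K * (κ * Real.exp (-(δ * x)) + e * R) * (e * ‖z - v‖)) := by gcongr
      _ = K * (κ * Real.exp (-(δ * x)) + e * R) * ‖z - v‖ * (Real.exp (l₁ * x) * e) := by ring
      _ = K * (κ * Real.exp (-(δ * x)) + e * R) * ‖z - v‖ := by rw [hee, mul_one]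
      _ ≤ K * (κ * Real.exp (-(μ * x)) + Real.exp (-(μ * x)) * R) * ‖z - v‖ := by gcongr
      _ = _ := by ring
  have hcontr : M * (K * (κ + R) / μ) ≤ 1 / 2 := by
    rw [← mul_div_assoc, div_le_iff₀ hμ]
    nlinarith
  obtain ⟨φ, ψ, g, hg, hφ, hψ, hgx, h0, h0', hbd⟩ := exists_decaying_solution (φ₀ := φ₀)
    (ψ₀ := ψ₀) hl₁ hl hμ (by positivity) (by positivity) hM hcontr hHc hH0 hHL
  have hsmall : 2 * M * (|φ₀| + |ψ₀| + K * κ / μ) ≤ R := by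
    rw [lt_div_iff₀ (by positivity)] at hε
    have h1 : 2 * M * (K * κ / μ) ≤ R / 2 := by
      rw [← mul_div_assoc, div_le_iff₀ hμ]
      nlinarith
    nlinarith
  have hcl' : ∀ y : ℝ, |y| ≤ R → max (-R) (min R y) = y := by
    intro y hy
    rw [min_eq_right (abs_le.1 hy).2, max_eq_right (abs_le.1 hy).1]
  have hee : ∀ x y : ℝ, Real.exp (-(l₁ * x)) * (Real.exp (l₁ * x) * y) = y := by
    intro x y
    rw [← mul_assoc, ← Real.exp_add]; simp
  have hee' : ∀ x y : ℝ, |Real.exp (l₁ * x) * y| ≤ R → |y| ≤ Real.exp (-(l₁ * x)) / 2 := by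
    intro x y h
    calc |y| = Real.exp (-(l₁ * x)) * |Real.exp (l₁ * x) * y| := by
          conv_lhs => rw [← hee x y, abs_mul, abs_of_pos (Real.exp_pos _)]
      _ ≤ Real.exp (-(l₁ * x)) * (1 / 2) := by gcongr; exact h.trans hR2
      _ = _ := by ring
  refine ⟨φ, ψ, g, hg, hφ, hψ, fun x hx => ?_, h0, h0', fun x hx => ?_⟩
  · obtain ⟨b1, b2⟩ := hbd x hx
    rw [hgx x hx]
    simp only [H]
    rw [hcl' _ (b1.trans hsmall), hcl' _ (b2.trans hsmall), hee, hee, hee]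
  · obtain ⟨b1, b2⟩ := hbd x hx
    exact ⟨hee' x _ (b1.trans hsmall), hee' x _ (b2.trans hsmall)⟩

section TailIntegral

variable {p r : ℝ} {F Finv : ℝ → ℝ}

theorem integrableOn_inv_sum_rpow (hp : 1 < p) (r : ℝ) {s : ℝ} (hs : 0 < s) :
    MeasureTheory.IntegrableOn (fun t : ℝ => (t ^ p + t ^ r)⁻¹) (Set.Ioi s) := by
  refine MeasureTheory.Integrable.mono'
    (integrableOn_Ioi_rpow_of_lt (a := -p) (by linarith) hs) ?_ ?_
  · refine ContinuousOn.aestronglyMeasurable (fun t ht => ContinuousAt.continuousWithinAt ?_)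
      measurableSet_Ioi
    have ht0 : 0 < t := hs.trans ht
    exact ((Real.continuousAt_rpow_const _ _ (Or.inl ht0.ne')).add
      (Real.continuousAt_rpow_const _ _ (Or.inl ht0.ne'))).inv₀
        (by positivity : t ^ p + t ^ r ≠ 0)
  · refine (MeasureTheory.ae_restrict_iff' measurableSet_Ioi).2 (Filter.Eventually.of_forall ?_)
    intro t ht
    have ht0 : 0 < t := hs.trans ht
    rw [Real.norm_of_nonneg (by positivity), Real.rpow_neg ht0.le]
    have : 0 < t ^ p := by positivity
    have : 0 < t ^ r := by positivity
    gcongr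
    linarith

theorem hasDerivAt_tailIntegral (hp : 1 < p)
    (hF : ∀ s : ℝ, F s = ∫ t in Set.Ioi s, (t ^ p + t ^ r)⁻¹) {s : ℝ} (hs : 0 < s) :
    HasDerivAt F (-(s ^ p + s ^ r)⁻¹) s := by
  have hs2 : 0 < s / 2 := by positivity
  have hi := integrableOn_inv_sum_rpow hp r hs2
  have hc : ContinuousOn (fun t : ℝ => (t ^ p + t ^ r)⁻¹) (Set.Ioi 0) := fun t ht => by
    have ht0 : 0 < t := ht
    exact (((Real.continuousAt_rpow_const _ _ (Or.inl ht0.ne')).add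
      (Real.continuousAt_rpow_const _ _ (Or.inl ht0.ne'))).inv₀
        (by positivity : t ^ p + t ^ r ≠ 0)).continuousWithinAt
  have h1 : HasDerivAt (fun x => ∫ t in (s / 2)..x, (t ^ p + t ^ r)⁻¹) (s ^ p + s ^ r)⁻¹ s := by
    refine intervalIntegral.integral_hasDerivAt_right ?_ ?_
      (hc.continuousAt (Ioi_mem_nhds hs))
    · refine (hc.mono fun t ht => ?_).intervalIntegrable
      rw [Set.uIcc_of_le (by linarith)] at ht
      exact hs2.trans_le ht.1
    · exact hc.stronglyMeasurableAtFilter isOpen_Ioi _ hs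
  refine (h1.const_sub (F (s / 2))).congr_of_eventuallyEq ?_
  filter_upwards [Ioi_mem_nhds (by linarith : s / 2 < s)] with x hx
  rw [hF x, hF (s / 2), ← intervalIntegral.integral_Ioi_sub_Ioi hi (le_of_lt hx)]
  ring

theorem strictAntiOn_tailIntegral (hp : 1 < p)
    (hF : ∀ s : ℝ, F s = ∫ t in Set.Ioi s, (t ^ p + t ^ r)⁻¹) :
    StrictAntiOn F (Set.Ioi 0) := by
  refine strictAntiOn_of_deriv_neg (convex_Ioi 0)
    (fun s hs => (hasDerivAt_tailIntegral hp hF hs).continuousAt.continuousWithinAt) ?_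
  intro s hs
  rw [interior_Ioi] at hs
  have hs0 : 0 < s := hs
  rw [(hasDerivAt_tailIntegral hp hF hs).deriv]
  have : 0 < (s ^ p + s ^ r)⁻¹ := by positivity
  linarith

theorem tailIntegral_le (hp : 1 < p)
    (hF : ∀ s : ℝ, F s = ∫ t in Set.Ioi s, (t ^ p + t ^ r)⁻¹) {s : ℝ} (hs : 0 < s) :
    F s ≤ s ^ (1 - p) / (p - 1) := by
  have h1 : ∫ t in Set.Ioi s, t ^ (-p) = s ^ (1 - p) / (p - 1) := by
    rw [integral_Ioi_rpow_of_lt (by linarith) hs, neg_div, ← div_neg]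
    ring_nf
  rw [hF, ← h1]
  refine MeasureTheory.setIntegral_mono_on (integrableOn_inv_sum_rpow hp r hs)
    (integrableOn_Ioi_rpow_of_lt (by linarith) hs) measurableSet_Ioi fun t ht => ?_
  have ht0 : 0 < t := hs.trans ht
  rw [Real.rpow_neg ht0.le]
  have : 0 < t ^ p := by positivity
  have : 0 < t ^ r := by positivity
  gcongr
  linarith

theorem le_tailIntegral (hp : 1 < p) (hrp : r < p)
    (hF : ∀ s : ℝ, F s = ∫ t in Set.Ioi s, (t ^ p + t ^ r)⁻¹) {s : ℝ} (hs : 0 < s) :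
    s ^ (1 - p) / (p - 1) ≤ (1 + s ^ (r - p)) * F s := by
  have h1 : ∫ t in Set.Ioi s, t ^ (-p) = s ^ (1 - p) / (p - 1) := by
    rw [integral_Ioi_rpow_of_lt (by linarith) hs, neg_div, ← div_neg]
    ring_nf
  rw [hF, ← h1, ← MeasureTheory.integral_const_mul]
  refine MeasureTheory.setIntegral_mono_on (integrableOn_Ioi_rpow_of_lt (by linarith) hs)
    ((integrableOn_inv_sum_rpow hp r hs).const_mul _) measurableSet_Ioi fun t ht => ?_
  have ht0 : 0 < t := hs.trans ht
  have htp : 0 < t ^ p := by positivity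
  have htr : 0 < t ^ r := by positivity
  have h2 : t ^ (r - p) ≤ s ^ (r - p) :=
    Real.rpow_le_rpow_of_nonpos hs (le_of_lt ht) (by linarith)
  rw [Real.rpow_sub ht0, div_le_iff₀ htp] at h2
  rw [Real.rpow_neg ht0.le, ← div_eq_mul_inv, inv_eq_one_div, div_le_div_iff₀ htp (by positivity)]
  nlinarith

theorem tailIntegral_pos (hp : 1 < p) (hrp : r < p)
    (hF : ∀ s : ℝ, F s = ∫ t in Set.Ioi s, (t ^ p + t ^ r)⁻¹) {s : ℝ} (hs : 0 < s) :
    0 < F s := by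
  have h1 := le_tailIntegral hp hrp hF hs
  have h2 : 0 < s ^ (1 - p) / (p - 1) := div_pos (by positivity) (by linarith)
  exact pos_of_mul_pos_right (h2.trans_le h1) (by positivity)

theorem exists_tailIntegral_eq (hp : 1 < p)
    (hF : ∀ s : ℝ, F s = ∫ t in Set.Ioi s, (t ^ p + t ^ r)⁻¹) {c y : ℝ} (hc : 0 < c)
    (hy : 0 < y) (hyc : y ≤ F c) : ∃ s, c ≤ s ∧ F s = y := by
  have hlim : Filter.Tendsto (fun s : ℝ => s ^ (-(p - 1)) / (p - 1)) Filter.atTop (nhds 0) := by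
    simpa using (tendsto_rpow_neg_atTop (by linarith : 0 < p - 1)).div_const (p - 1)
  obtain ⟨s₁, hs₁, hcs⟩ :=
    ((hlim.eventually_lt_const hy).and (Filter.eventually_ge_atTop c)).exists
  have h1 := tailIntegral_le hp hF (hc.trans_le hcs)
  rw [neg_sub] at hs₁
  obtain ⟨s, hs, hsy⟩ := intermediate_value_Icc' hcs (f := F)
    (fun s hs => (hasDerivAt_tailIntegral hp hF
      (hc.trans_le hs.1)).continuousAt.continuousWithinAt) ⟨h1.trans hs₁.le, hyc⟩
  exact ⟨s, hs.1, hsy⟩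

theorem hasDerivAt_leftInverse_tailIntegral (hp : 1 < p)
    (hF : ∀ s : ℝ, F s = ∫ t in Set.Ioi s, (t ^ p + t ^ r)⁻¹)
    (hFinv : ∀ s : ℝ, 0 < s → Finv (F s) = s) {s : ℝ} (hs : 0 < s) :
    HasDerivAt Finv (-(s ^ p + s ^ r)) (F s) := by
  have h1 : HasStrictDerivAt F (-(s ^ p + s ^ r)⁻¹) s := by
    refine hasStrictDerivAt_of_hasDerivAt_of_continuousAt
      (f' := fun s => -(s ^ p + s ^ r)⁻¹) ?_ ?_
    · filter_upwards [Ioi_mem_nhds hs] with x hx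
      exact hasDerivAt_tailIntegral hp hF hx
    · exact (((Real.continuousAt_rpow_const _ _ (Or.inl hs.ne')).add
        (Real.continuousAt_rpow_const _ _ (Or.inl hs.ne'))).inv₀
        (by positivity : s ^ p + s ^ r ≠ 0)).neg
  have hne : (s ^ p + s ^ r) ≠ 0 := by positivity
  have h2 := h1.to_local_left_inverse (g := Finv) (neg_ne_zero.2 (inv_ne_zero hne)) (by
    filter_upwards [Ioi_mem_nhds hs] with x hx
    exact hFinv x hx)
  exact h2.hasDerivAt.congr_deriv (by rw [inv_neg, inv_inv])

theorem abs_tailIntegral_mul_div_sub_le (hp : 1 < p) (hrp : r < p)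
    (hF : ∀ s : ℝ, F s = ∫ t in Set.Ioi s, (t ^ p + t ^ r)⁻¹) {s : ℝ} (hs : 0 < s) :
    |F s * (s ^ p + s ^ r) / s - 1 / (p - 1)| ≤ s ^ (r - p) / (p - 1) := by
  have h1 := tailIntegral_le hp hF hs
  have h2 := le_tailIntegral hp hrp hF hs
  have hp1 : 0 < p - 1 := by linarith
  have e0 : s ^ (1 - p) * s ^ (p - 1) = 1 := by
    rw [← Real.rpow_add hs]; simp
  have e1 : F s * (s ^ p + s ^ r) / s = (1 + s ^ (r - p)) * F s * s ^ (p - 1) := by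
    rw [Real.rpow_sub hs, Real.rpow_sub hs, Real.rpow_one]
    field_simp
  have hpow : 0 < s ^ (p - 1) := by positivity
  have e2 : s ^ (1 - p) / (p - 1) * s ^ (p - 1) = 1 / (p - 1) := by
    rw [div_mul_eq_mul_div, e0]
  have h3 := mul_le_mul_of_nonneg_right h2 hpow.le
  have h4 : (1 + s ^ (r - p)) * F s * s ^ (p - 1) ≤
      (1 + s ^ (r - p)) * (s ^ (1 - p) / (p - 1)) * s ^ (p - 1) := by gcongr
  rw [mul_assoc _ (s ^ (1 - p) / (p - 1)), e2] at h4
  rw [e2] at h3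
  have e3 : (1 + s ^ (r - p)) * (1 / (p - 1)) = 1 / (p - 1) + s ^ (r - p) / (p - 1) := by ring
  rw [e1, abs_le]
  have : 0 ≤ s ^ (r - p) / (p - 1) := by positivity
  constructor <;> linarith

theorem rpow_sub_le_tailIntegral_rpow (hp : 1 < p) (hrp : r < p)
    (hF : ∀ s : ℝ, F s = ∫ t in Set.Ioi s, (t ^ p + t ^ r)⁻¹) {s : ℝ} (hs : 1 ≤ s) :
    s ^ (r - p) ≤ (2 * (p - 1) * F s) ^ ((p - r) / (p - 1)) := by
  have hs0 : 0 < s := by linarith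
  have hp1 : 0 < p - 1 := by linarith
  have h2 := le_tailIntegral hp hrp hF hs0
  have hw : s ^ (r - p) ≤ 1 := Real.rpow_le_one_of_one_le_of_nonpos hs (by linarith)
  have hF0 := tailIntegral_pos hp hrp hF hs0
  have h3 : s ^ (1 - p) ≤ 2 * (p - 1) * F s := by
    rw [div_le_iff₀ hp1] at h2
    nlinarith [mul_pos hF0 hp1]
  calc s ^ (r - p) = (s ^ (1 - p)) ^ ((p - r) / (p - 1)) := by
        rw [← Real.rpow_mul hs0.le]
        congr 1
        field_simp
        ring
    _ ≤ _ := Real.rpow_le_rpow (by positivity) h3 (div_nonneg (by linarith) hp1.le)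

end TailIntegral

/-- The radial equation for `u = s (1 + θ)` follows from the equation for the perturbation in
logarithmic variables. -/
theorem radial_equation_of_perturbation {n p r b s ρ A w φ ψ g l₁ l₂ : ℝ}
    (hp : p - 1 ≠ 0) (hb : b = 2 * n - 4 * p / (p - 1)) (hb0 : b ≠ 0) (hs : 0 < s) (hρ : ρ ≠ 0)
    (hφ : 0 ≤ 1 + φ) (hsum : l₁ + l₂ = 4 / (p - 1) - n + 2) (hprod : l₁ * l₂ = b)
    (hA : A = ρ ^ 2 / b * (s ^ p + s ^ r) / s) (hw : w = s ^ r / (s ^ p + s ^ r))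
    (hg : g = perturbRemainder p r b (A - 1 / (p - 1)) w φ ψ) :
    ((-((p * s ^ (p - 1) + r * s ^ (r - 1)) * (-(s ^ p + s ^ r) * (2 * ρ / b)) * (2 * ρ / b)) -
        (s ^ p + s ^ r) * (2 / b)) * (1 + φ) +
      2 * (-(s ^ p + s ^ r) * (2 * ρ / b)) * (-ψ / ρ) +
      s * ((-(l₁ + l₂) * ψ - l₁ * l₂ * φ + g + ψ) / ρ ^ 2)) +
      ((n - 1) / ρ) * (-(s ^ p + s ^ r) * (2 * ρ / b) * (1 + φ) + s * (-ψ / ρ)) +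
      (s * (1 + φ)) ^ p + (s * (1 + φ)) ^ r = 0 := by
  have hf : 0 < s ^ p + s ^ r := by positivity
  have hn : n = b / 2 + 2 * p / (p - 1) := by rw [hb]; ring
  have hfA : s ^ p + s ^ r = A * b * s / ρ ^ 2 := by rw [hA]; field_simp
  have hY : s ^ r = w * (A * b * s / ρ ^ 2) := by rw [← hfA, hw]; field_simp
  have hX : s ^ p = (1 - w) * (A * b * s / ρ ^ 2) := by linear_combination hfA - hY
  rw [Real.mul_rpow hs.le hφ, Real.mul_rpow hs.le hφ, Real.rpow_sub hs, Real.rpow_sub hs,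
    Real.rpow_one, hsum, hprod, hg, perturbRemainder, hn]
  rw [hfA, hX, hY]
  clear hX hY hfA hn hA hw hg hf hsum hprod hb
  generalize (1 + φ) ^ p = P
  generalize (1 + φ) ^ r = Q
  field_simp
  ring

theorem exponent_relations {N : ℕ} (hN : 3 ≤ N) {p r b : ℝ}
    (hpc : (N : ℝ) / ((N : ℝ) - 2) < p) (hpstar : p < pStar N) (hrstar : r < rStar N p)
    (hb : b = 2 * (N : ℝ) - 4 * p / (p - 1)) :
    1 < p ∧ r < p ∧ 0 < b ∧ 0 < lamOne N p ∧ lamOne N p < 2 * (p - r) / (p - 1) ∧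
      ∃ l₂, lamOne N p < l₂ ∧ lamOne N p + l₂ = 4 / (p - 1) - N + 2 ∧ lamOne N p * l₂ = b := by
  rw [rStar, if_pos hpstar] at hrstar
  unfold pStar at hpstar
  unfold lamOne
  have hn : (3 : ℝ) ≤ N := by exact_mod_cast hN
  generalize (N : ℝ) = n at *
  set q := Real.sqrt (n - 1) with hq
  have hq2 : q ^ 2 = n - 1 := Real.sq_sqrt (by linarith)
  have hq0 : 0 ≤ q := Real.sqrt_nonneg _
  have hq1 : 1 < q := by nlinarith
  have hn2 : 0 < n - 2 := by linarith
  have hp : 1 < p := lt_trans ((one_lt_div hn2).2 (by linarith)) hpc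
  have hp1 : 0 < p - 1 := by linarith
  obtain ⟨m, hm⟩ : ∃ m, m = 2 / (p - 1) := ⟨_, rfl⟩
  have hm0 : 0 < m := by rw [hm]; positivity
  have hmp : m * (p - 1) = 2 := by rw [hm]; field_simp
  have h4 : 4 / (p - 1) = 2 * m := by rw [hm]; ring
  have hmn : m < n - 2 := by
    rw [div_lt_iff₀ hn2] at hpc
    rw [hm, div_lt_iff₀ hp1]
    nlinarith
  have hmq : n - 4 + 2 * q < 2 * m := by
    have h1 : p - 1 < 4 / (n - 4 + 2 * q) := by linarith
    rw [lt_div_iff₀ (by linarith)] at h1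
    rw [← h4, lt_div_iff₀ hp1]
    linarith
  have hbm : b = 2 * (n - 2 - m) := by
    rw [hb, hm]; field_simp; ring
  rw [h4, ← hm] at hrstar
  rw [h4, ← hm]
  set D := (n - 2 - 2 * m) ^ 2 - 8 * (n - 2 - m) with hD
  have hDpos : 0 < D := by
    have : D = (2 * m - (n - 4) - 2 * q) * (2 * m - (n - 4) + 2 * q) := by
      rw [hD]; linear_combination 4 * hq2
    rw [this]
    exact mul_pos (by linarith) (by linarith)
  have hS2 : Real.sqrt D ^ 2 = D := Real.sq_sqrt hDpos.le
  have hS0 : 0 < Real.sqrt D := Real.sqrt_pos.2 hDpos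
  have hS1 : Real.sqrt D < 2 * m - n + 2 := by
    rw [Real.sqrt_lt' (by linarith), hD]
    nlinarith
  have hmr : m * r < (n - 2 - Real.sqrt D) / 2 := by
    have h1 := mul_lt_mul_of_pos_left hrstar hm0
    have h2 : m * ((p - 1) / 4 * (n - 2 - Real.sqrt D)) = (n - 2 - Real.sqrt D) / 2 := by
      linear_combination (n - 2 - Real.sqrt D) / 4 * hmp
    linarith
  have hr1 : r < 1 := by
    by_contra h
    nlinarith
  have hδ : 2 * (p - r) / (p - 1) = m * (p - r) := by rw [hm]; ring
  refine ⟨hp, by linarith, by linarith, by linarith, ?_,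
    (2 * m - n + 2 + Real.sqrt D) / 2, by linarith, by ring, ?_⟩
  · rw [hδ]
    linarith
  · rw [hbm]
    linear_combination (-1 / 4) * hS2 + (-1 / 4) * hD

/-- Properties of the profile `ũ(ρ) = F⁻¹(ρ² / b)` near the origin. -/
theorem profile_properties {p r b : ℝ} {F Finv : ℝ → ℝ} (hp : 1 < p) (hrp : r < p) (hb : 0 < b)
    (hF : ∀ s : ℝ, F s = ∫ t in Set.Ioi s, (t ^ p + t ^ r)⁻¹)
    (hFinv : ∀ s : ℝ, 0 < s → Finv (F s) = s) :
    ∃ K : ℝ, 0 < K ∧ ∀ ρ s : ℝ, 0 < ρ → ρ ^ 2 / b ≤ F 1 → s = Finv (ρ ^ 2 / b) →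
      1 ≤ s ∧ F s = ρ ^ 2 / b ∧
      HasDerivAt (fun x => Finv (x ^ 2 / b)) (-(s ^ p + s ^ r) * (2 * ρ / b)) ρ ∧
      |ρ ^ 2 / b * (s ^ p + s ^ r) / s - 1 / (p - 1)| ≤ K * ρ ^ (2 * (p - r) / (p - 1)) ∧
      |s ^ r / (s ^ p + s ^ r)| ≤ K * ρ ^ (2 * (p - r) / (p - 1)) := by
  have hp1 : 0 < p - 1 := by linarith
  set c := (2 * (p - 1) / b) ^ ((p - r) / (p - 1)) with hc
  have hc0 : 0 < c := by positivity
  have hinv : 0 < 1 / (p - 1) := by positivity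
  refine ⟨(1 + 1 / (p - 1)) * c, by positivity, fun ρ s hρ hρF hs => ?_⟩
  obtain ⟨s', hs1, hFs⟩ := exists_tailIntegral_eq hp hF one_pos (by positivity) hρF
  have hs0 : 0 < s' := by linarith
  obtain rfl : s = s' := by rw [hs, ← hFs, hFinv s' hs0]
  have hw : s ^ (r - p) ≤ c * ρ ^ (2 * (p - r) / (p - 1)) := by
    refine (rpow_sub_le_tailIntegral_rpow hp hrp hF hs1).trans_eq ?_
    rw [hFs, hc, show 2 * (p - 1) * (ρ ^ 2 / b) = 2 * (p - 1) / b * ρ ^ 2 by ring,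
      Real.mul_rpow (by positivity) (by positivity)]
    congr 1
    rw [← Real.rpow_natCast, ← Real.rpow_mul hρ.le]
    congr 1
    push_cast
    ring
  set X := c * ρ ^ (2 * (p - r) / (p - 1)) with hX
  have hX0 : 0 < X := by positivity
  refine ⟨hs1, hFs, ?_, ?_, ?_⟩
  · have h1 := hasDerivAt_leftInverse_tailIntegral hp hF hFinv hs0
    rw [hFs] at h1
    have h2 : HasDerivAt (fun x : ℝ => x ^ 2 / b) (2 * ρ / b) ρ :=
      ((hasDerivAt_pow 2 ρ).div_const b).congr_deriv (by norm_num)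
    exact h1.comp ρ h2
  · rw [← hFs, mul_assoc, ← hX]
    refine (abs_tailIntegral_mul_div_sub_le hp hrp hF hs0).trans ?_
    calc s ^ (r - p) / (p - 1) = 1 / (p - 1) * s ^ (r - p) := by ring
      _ ≤ 1 / (p - 1) * X := by gcongr
      _ ≤ (1 + 1 / (p - 1)) * X := by gcongr; linarith
  · have hsr : 0 < s ^ r := by positivity
    have hsp : 0 < s ^ p := by positivity
    rw [mul_assoc, ← hX, abs_of_pos (by positivity)]
    calc s ^ r / (s ^ p + s ^ r) ≤ s ^ r / s ^ p := by gcongr; linarith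
      _ = s ^ (r - p) := (Real.rpow_sub hs0 _ _).symm
      _ ≤ X := hw
      _ ≤ (1 + 1 / (p - 1)) * X := by nlinarith [mul_pos hinv hX0]

theorem tendsto_profile_atTop {p r b : ℝ} {F Finv : ℝ → ℝ} (hp : 1 < p) (hrp : r < p)
    (hb : 0 < b) (hF : ∀ s : ℝ, F s = ∫ t in Set.Ioi s, (t ^ p + t ^ r)⁻¹)
    (hFinv : ∀ s : ℝ, 0 < s → Finv (F s) = s) :
    Filter.Tendsto (fun ρ => Finv (ρ ^ 2 / b)) (nhdsWithin 0 (Set.Ioi 0)) Filter.atTop := by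
  rw [Filter.tendsto_atTop]
  intro B
  have hB : 0 < max B 1 := lt_max_of_lt_right one_pos
  have hlim : Filter.Tendsto (fun ρ : ℝ => ρ ^ 2 / b) (nhdsWithin 0 (Set.Ioi 0)) (nhds 0) := by
    have : Continuous fun ρ : ℝ => ρ ^ 2 / b := by fun_prop
    simpa using (this.tendsto 0).mono_left nhdsWithin_le_nhds
  filter_upwards [hlim.eventually_le_const (tailIntegral_pos hp hrp hF hB),
    self_mem_nhdsWithin] with ρ hρ hρ0
  have hρ0 : 0 < ρ := hρ0
  obtain ⟨s, hs, hFs⟩ := exists_tailIntegral_eq hp hF hB (by positivity) hρ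
  rw [← hFs, hFinv s (hB.trans_le hs)]
  exact (le_max_left _ _).trans hs

/-- Corollary 1.1, case `p_c < p < p_*`, `0 < r < r^*`: for
`f(s) = s^p + s^r`, there are infinitely many radial singular solutions
`u(ρ) = ũ(ρ)(1+θ(ρ))` of `−Δu = u^p + u^r`, with `ũ(ρ) = F⁻¹(ρ²/b)`,
`b = 2N − 4p/(p−1)`, and `|θ(ρ)| + ρ|θ'(ρ)| ≤ C ρ^{λ₁}`. -/
theorem singular_solution_sum_powers_subcritical (N : ℕ) (hN : 3 ≤ N)
    (p r : ℝ) (F Finv : ℝ → ℝ) (b : ℝ)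
    (hpc : (N : ℝ) / ((N : ℝ) - 2) < p)
    (hpstar : p < pStar N)
    (hr0 : 0 < r) (hrstar : r < rStar N p)
    (hF : ∀ s : ℝ, F s = ∫ t in Set.Ioi s, (t ^ p + t ^ r)⁻¹)
    (hFinv : ∀ s : ℝ, 0 < s → Finv (F s) = s)
    (hb : b = 2 * (N : ℝ) - 4 * p / (p - 1)) :
    ∃ r₀ : ℝ, 0 < r₀ ∧ ∃ ε : ℝ, 0 < ε ∧ ∃ C : ℝ, 0 < C ∧
      ∀ α β : ℝ, 0 < α → 0 < β → α + β < ε →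
        ∃ θ θ' : ℝ → ℝ,
          ContDiffOn ℝ 2 θ (Set.Ioo 0 r₀) ∧
          (∀ ρ ∈ Set.Ioc (0 : ℝ) r₀,
            HasDerivWithinAt θ (θ' ρ) (Set.Ioc 0 r₀) ρ) ∧
          ContinuousOn θ' (Set.Ioc 0 r₀) ∧
          θ r₀ = α ∧ r₀ * θ' r₀ = -β ∧
          (∀ ρ ∈ Set.Ioo (0 : ℝ) r₀, 0 < Finv (ρ ^ 2 / b) * (1 + θ ρ)) ∧
          (∃ u' u'' : ℝ → ℝ,
            (∀ ρ ∈ Set.Ioo (0 : ℝ) r₀,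
              HasDerivAt (fun x => Finv (x ^ 2 / b) * (1 + θ x)) (u' ρ) ρ) ∧
            (∀ ρ ∈ Set.Ioo (0 : ℝ) r₀, HasDerivAt u' (u'' ρ) ρ) ∧
            (∀ ρ ∈ Set.Ioo (0 : ℝ) r₀,
              u'' ρ + (((N : ℝ) - 1) / ρ) * u' ρ +
                (Finv (ρ ^ 2 / b) * (1 + θ ρ)) ^ p +
                (Finv (ρ ^ 2 / b) * (1 + θ ρ)) ^ r = 0)) ∧
          Filter.Tendsto (fun ρ => Finv (ρ ^ 2 / b) * (1 + θ ρ))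
            (nhdsWithin 0 (Set.Ioi 0)) Filter.atTop ∧
          (∀ ρ ∈ Set.Ioo (0 : ℝ) r₀,
            |θ ρ| + ρ * |θ' ρ| ≤ C * ρ ^ lamOne N p) := by
  obtain ⟨hp, hrp, hb0, hl₁, hδ, l₂, hl, hsum, hprod⟩ :=
    exponent_relations hN hpc hpstar hrstar hb
  set l₁ := lamOne N p
  set δ := 2 * (p - r) / (p - 1) with hδdef
  have hp1 : 0 < p - 1 := by linarith
  have hδ0 : 0 < δ := hl₁.trans hδ
  obtain ⟨κ, ε, hκ, hε, hpert⟩ := exists_perturbation (p := p) (r := r) (b := b) (by linarith)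
    hr0.le hl₁ hl hδ
  obtain ⟨K, hK, hprof⟩ := profile_properties hp hrp hb0 hF hFinv
  rw [← hδdef] at hprof
  obtain ⟨r₀, ⟨hr₀F, hr₀κ⟩, hr₀⟩ : ∃ r₀ : ℝ, (r₀ ^ 2 / b ≤ F 1 ∧ K * r₀ ^ δ ≤ κ) ∧ 0 < r₀ := by
    have h1 : Continuous fun ρ : ℝ => ρ ^ 2 / b := by fun_prop
    have h2 : Continuous fun ρ : ℝ => K * ρ ^ δ :=
      continuous_const.mul (continuous_id.rpow_const fun _ => Or.inr hδ0.le)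
    have t1 : Filter.Tendsto (fun ρ : ℝ => ρ ^ 2 / b) (nhdsWithin 0 (Set.Ioi 0)) (nhds 0) := by
      simpa using (h1.tendsto 0).mono_left nhdsWithin_le_nhds
    have t2 : Filter.Tendsto (fun ρ : ℝ => K * ρ ^ δ) (nhdsWithin 0 (Set.Ioi 0)) (nhds 0) := by
      simpa [Real.zero_rpow hδ0.ne'] using (h2.tendsto 0).mono_left nhdsWithin_le_nhds
    exact (((t1.eventually_le_const (tailIntegral_pos hp hrp hF one_pos)).and
      (t2.eventually_le_const hκ)).and self_mem_nhdsWithin).exists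
  set U : ℝ → ℝ := fun ρ => Finv (ρ ^ 2 / b) with hU
  have hle : ∀ {ρ : ℝ}, 0 < ρ → ρ ≤ r₀ → ρ ^ 2 / b ≤ F 1 := fun {ρ} h0 h1 =>
    le_trans (by gcongr) hr₀F
  have hU1 : ∀ {ρ : ℝ}, 0 < ρ → ρ ≤ r₀ → 1 ≤ U ρ := fun h0 h1 =>
    (hprof _ _ h0 (hle h0 h1) rfl).1
  have hUd : ∀ {ρ : ℝ}, 0 < ρ → ρ ≤ r₀ →
      HasDerivAt U (-(U ρ ^ p + U ρ ^ r) * (2 * ρ / b)) ρ := fun h0 h1 =>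
    (hprof _ _ h0 (hle h0 h1) rfl).2.2.1
  let R : ℝ → ℝ := fun x => r₀ * Real.exp (-(max 0 x))
  have hR0 : ∀ x, 0 < R x := fun x => mul_pos hr₀ (Real.exp_pos _)
  have hRle : ∀ x, R x ≤ r₀ := fun x =>
    mul_le_of_le_one_right hr₀.le (Real.exp_le_one_iff.2 (by simp))
  have hRc : Continuous R := by simp only [R]; fun_prop
  have hRδ : ∀ x, 0 ≤ x → K * R x ^ δ ≤ κ * Real.exp (-(δ * x)) := by
    intro x hx
    simp only [R]
    rw [max_eq_right hx, Real.mul_rpow hr₀.le (Real.exp_pos _).le, ← Real.exp_mul, ← mul_assoc,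
      show -x * δ = -(δ * x) by ring]
    gcongr
  have hURc : Continuous fun x => U (R x) := continuous_iff_continuousAt.2 fun x =>
    ContinuousAt.comp (f := R) (hUd (hR0 x) (hRle x)).continuousAt hRc.continuousAt
  have hUR0 : ∀ x, 0 < U (R x) := fun x => one_pos.trans_le (hU1 (hR0 x) (hRle x))
  have hURp : ∀ q : ℝ, Continuous fun x => U (R x) ^ q := fun q =>
    hURc.rpow_const fun x => Or.inl (hUR0 x).ne'
  have hfpos : ∀ x, 0 < U (R x) ^ p + U (R x) ^ r := fun x => by
    have := hUR0 x
    positivity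
  specialize hpert
    (fun x => R x ^ 2 / b * (U (R x) ^ p + U (R x) ^ r) / U (R x) - 1 / (p - 1))
    (fun x => U (R x) ^ r / (U (R x) ^ p + U (R x) ^ r))
    (((((hRc.pow 2).div_const b).mul ((hURp p).add (hURp r))).div₀ hURc
      fun x => (hUR0 x).ne').sub continuous_const)
    ((hURp r).div₀ ((hURp p).add (hURp r)) fun x => (hfpos x).ne')
    (fun x hx => ((hprof _ _ (hR0 x) (hle (hR0 x) (hRle x)) rfl).2.2.2.1).trans (hRδ x hx))
    (fun x hx => ((hprof _ _ (hR0 x) (hle (hR0 x) (hRle x)) rfl).2.2.2.2).trans (hRδ x hx))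
  refine ⟨r₀, hr₀, ε, hε, 1 / r₀ ^ l₁, by positivity, fun α β hα hβ hαβ => ?_⟩
  obtain ⟨φ, ψ, g, hg, hφ, hψ, hgx, hφ0, hψ0, hdecay⟩ := hpert α β
    (by rwa [abs_of_pos hα, abs_of_pos hβ])
  let ℓ : ℝ → ℝ := fun ρ => Real.log r₀ - Real.log ρ
  have hℓd : ∀ {ρ : ℝ}, 0 < ρ → HasDerivAt ℓ (-ρ⁻¹) ρ := fun h0 =>
    (Real.hasDerivAt_log h0.ne').const_sub _
  have hℓ0 : ∀ {ρ : ℝ}, 0 < ρ → ρ ≤ r₀ → 0 ≤ ℓ ρ := fun h0 h1 =>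
    sub_nonneg.2 (Real.log_le_log h0 h1)
  have hRℓ : ∀ {ρ : ℝ}, 0 < ρ → ρ ≤ r₀ → R (ℓ ρ) = ρ := by
    intro ρ h0 h1
    simp only [R]
    rw [max_eq_right (hℓ0 h0 h1)]
    simp only [ℓ]
    rw [neg_sub, Real.exp_sub, Real.exp_log h0, Real.exp_log hr₀]
    field_simp
  have hℓr : ℓ r₀ = 0 := sub_self _
  have hθd : ∀ {ρ : ℝ}, 0 < ρ → HasDerivAt (fun ρ => φ (ℓ ρ)) (-ψ (ℓ ρ) / ρ) ρ := fun {ρ} h0 =>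
    ((hφ (ℓ ρ)).comp ρ (hℓd h0)).congr_deriv (by ring)
  have hθ'd : ∀ {ρ : ℝ}, 0 < ρ → HasDerivAt (fun ρ => -ψ (ℓ ρ) / ρ)
      ((-(l₁ + l₂) * ψ (ℓ ρ) - l₁ * l₂ * φ (ℓ ρ) + g (ℓ ρ) + ψ (ℓ ρ)) / ρ ^ 2) ρ := by
    intro ρ h0
    refine ((((hψ (ℓ ρ)).comp ρ (hℓd h0)).neg).div (hasDerivAt_id ρ) h0.ne').congr_deriv ?_
    simp only [id, Pi.neg_apply, Function.comp_apply]
    field_simp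
    ring
  have hψc : Continuous ψ := continuous_iff_continuousAt.2 fun x => (hψ x).continuousAt
  have hφc : Continuous φ := continuous_iff_continuousAt.2 fun x => (hφ x).continuousAt
  have hφ2 : ContDiff ℝ 2 φ := by
    have e1 : deriv φ = ψ := funext fun x => (hφ x).deriv
    have e2 : deriv ψ = fun x => -(l₁ + l₂) * ψ x - l₁ * l₂ * φ x + g x :=
      funext fun x => (hψ x).deriv
    rw [show (2 : WithTop ℕ∞) = 1 + 1 by norm_num, contDiff_succ_iff_deriv, e1,
      contDiff_one_iff_deriv, e2]
    exact ⟨fun x => (hφ x).differentiableAt, by simp, fun x => (hψ x).differentiableAt,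
      by fun_prop⟩
  have hexp : ∀ {ρ : ℝ}, 0 < ρ → Real.exp (-(l₁ * ℓ ρ)) = 1 / r₀ ^ l₁ * ρ ^ l₁ := by
    intro ρ h0
    rw [Real.rpow_def_of_pos hr₀, Real.rpow_def_of_pos h0, one_div, ← Real.exp_neg,
      ← Real.exp_add]
    simp only [ℓ]
    ring_nf
  have hφhalf : ∀ {ρ : ℝ}, 0 < ρ → ρ ≤ r₀ → 1 / 2 ≤ 1 + φ (ℓ ρ) := by
    intro ρ h0 h1
    have h2 := (hdecay _ (hℓ0 h0 h1)).1
    have h3 : Real.exp (-(l₁ * ℓ ρ)) ≤ 1 :=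
      Real.exp_le_one_iff.2 (neg_nonpos.2 (mul_nonneg hl₁.le (hℓ0 h0 h1)))
    linarith [(abs_le.1 h2).1]
  refine ⟨fun ρ => φ (ℓ ρ), fun ρ => -ψ (ℓ ρ) / ρ, ?_, fun ρ hρ => (hθd hρ.1).hasDerivWithinAt,
    fun ρ hρ => (hθ'd hρ.1).continuousAt.continuousWithinAt, ?_, ?_, ?_, ?_, ?_, ?_⟩
  · refine hφ2.comp_contDiffOn (contDiffOn_const.sub fun ρ hρ => ?_)
    exact (Real.contDiffAt_log.2 hρ.1.ne').contDiffWithinAt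
  · simp only [hℓr, hφ0]
  · simp only [hℓr, hψ0]
    field_simp
  · intro ρ hρ
    have h1 := hU1 hρ.1 hρ.2.le
    have h2 := hφhalf hρ.1 hρ.2.le
    exact mul_pos (by linarith) (by linarith)
  · refine ⟨fun ρ => -(U ρ ^ p + U ρ ^ r) * (2 * ρ / b) * (1 + φ (ℓ ρ)) +
        U ρ * (-ψ (ℓ ρ) / ρ),
      fun ρ => (-((p * U ρ ^ (p - 1) + r * U ρ ^ (r - 1)) *
          (-(U ρ ^ p + U ρ ^ r) * (2 * ρ / b)) * (2 * ρ / b)) -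
          (U ρ ^ p + U ρ ^ r) * (2 / b)) * (1 + φ (ℓ ρ)) +
        2 * (-(U ρ ^ p + U ρ ^ r) * (2 * ρ / b)) * (-ψ (ℓ ρ) / ρ) +
        U ρ * ((-(l₁ + l₂) * ψ (ℓ ρ) - l₁ * l₂ * φ (ℓ ρ) + g (ℓ ρ) + ψ (ℓ ρ)) / ρ ^ 2),
      fun ρ hρ => ?_, fun ρ hρ => ?_, fun ρ hρ => ?_⟩
    · exact (hUd hρ.1 hρ.2.le).mul ((hθd hρ.1).const_add 1)
    · have hUρ : U ρ ≠ 0 := by linarith [hU1 hρ.1 hρ.2.le]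
      have d0 := hUd hρ.1 hρ.2.le
      have d1 := (d0.rpow_const (p := p) (Or.inl hUρ)).add (d0.rpow_const (p := r) (Or.inl hUρ))
      have d2 : HasDerivAt (fun x : ℝ => 2 * x / b) (2 / b) ρ :=
        (((hasDerivAt_id ρ).const_mul 2).div_const b).congr_deriv (by ring)
      refine (((d1.neg.mul d2).mul ((hθd hρ.1).const_add 1)).add
        (d0.mul (hθ'd hρ.1))).congr_deriv ?_
      simp only [Pi.neg_apply, Pi.add_apply, Pi.mul_apply]
      ring
    · have hρU := one_pos.trans_le (hU1 hρ.1 hρ.2.le)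
      have hgρ := hgx _ (hℓ0 hρ.1 hρ.2.le)
      simp only [hRℓ hρ.1 hρ.2.le] at hgρ
      exact radial_equation_of_perturbation hp1.ne' hb hb0.ne' hρU hρ.1.ne'
        (by linarith [hφhalf hρ.1 hρ.2.le]) hsum hprod rfl rfl hgρ
  · have hT := tendsto_profile_atTop hp hrp hb0 hF hFinv
    refine Filter.tendsto_atTop_mono' _ ?_ (hT.atTop_mul_const (r := 1 / 2) (by norm_num))
    filter_upwards [Ioc_mem_nhdsGT hr₀] with ρ hρ
    have := hU1 hρ.1 hρ.2
    exact mul_le_mul_of_nonneg_left (hφhalf hρ.1 hρ.2) (zero_le_one.trans this)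
  · intro ρ hρ
    obtain ⟨h1, h2⟩ := hdecay _ (hℓ0 hρ.1 hρ.2.le)
    rw [hexp hρ.1] at h1 h2
    have h3 : ρ * |(-ψ (ℓ ρ) / ρ)| = |ψ (ℓ ρ)| := by
      rw [abs_div, abs_neg, abs_of_pos hρ.1]
      field_simp [hρ.1.ne']
    simp only [h3]
    linarith
end

section
/- Suppose additionally that f''(s) > 0 for all sufficiently large s, that f'(s) → ∞ as s → ∞, and that the limit q := lim_{s→∞} f'(s)²/(f(s)f''(s)) exists and is finite. Then lim_{s→∞} f'(s)F(s) = q. -/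
open Set Filter Topology MeasureTheory

/-- If `f'' > 0` for all large `s`, `f'(s) → ∞`, and the limit
`q = lim_{s→∞} f'(s)²/(f(s)·f''(s))` exists and is finite, then
`f'(s)·F(s) → q` as `s → ∞`, where `F(s) = ∫_s^∞ dt/f(t)`. -/
theorem deriv_mul_F_tendsto (f F : ℝ → ℝ) (q : ℝ)
    (hf : ContDiffOn ℝ 2 f (Set.Ioi 0))
    (hfpos : ∀ s : ℝ, 0 < s → 0 < f s)
    (hf'pos : ∀ s : ℝ, 0 < s → 0 < deriv f s)
    (hfint : ∀ s : ℝ, 0 < s →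
      MeasureTheory.IntegrableOn (fun t => (f t)⁻¹) (Set.Ioi s))
    (hF : ∀ s : ℝ, F s = ∫ t in Set.Ioi s, (f t)⁻¹)
    (hf''pos : ∀ᶠ s in Filter.atTop, 0 < deriv (deriv f) s)
    (hf'top : Filter.Tendsto (deriv f) Filter.atTop Filter.atTop)
    (hq : Filter.Tendsto (fun s => (deriv f s) ^ 2 / (f s * deriv (deriv f) s))
      Filter.atTop (nhds q)) :
    Filter.Tendsto (fun s => deriv f s * F s) Filter.atTop (nhds q) := by
  have hF_eq : ∀ s : ℝ, 1 < s → F s = F 1 - ∫ t in (1 : ℝ)..s, (f t)⁻¹ := by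
    intro s hs
    have h := intervalIntegral.integral_Ioi_sub_Ioi (hfint 1 one_pos) hs.le
    rw [hF, hF, ← h]
    ring
  have hF_zero : Tendsto F atTop (𝓝 0) := by
    have h := intervalIntegral_tendsto_integral_Ioi 1 (hfint 1 one_pos) tendsto_id
    have h' := (tendsto_const_nhds (x := F 1)).sub h
    rw [← hF, sub_self] at h'
    refine h'.congr' ?_
    filter_upwards [eventually_gt_atTop 1] with s hs
    exact (hF_eq s hs).symm
  have hcont : ContinuousOn (fun t => (f t)⁻¹) (Ioi 0) :=
    hf.continuousOn.inv₀ fun t ht => (hfpos t ht).ne'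
  have hF_deriv : ∀ s : ℝ, 1 < s → HasDerivAt F (-(f s)⁻¹) s := by
    intro s hs
    have hs0 : Ioi (0 : ℝ) ∈ 𝓝 s := Ioi_mem_nhds (one_pos.trans hs)
    have hint : IntervalIntegrable (fun t => (f t)⁻¹) volume 1 s :=
      (hcont.mono fun t ht => by
        rw [uIcc_of_le hs.le] at ht
        exact one_pos.trans_le ht.1).intervalIntegrable
    have h := (intervalIntegral.integral_hasDerivAt_right hint
      (hcont.stronglyMeasurableAtFilter isOpen_Ioi s (one_pos.trans hs))
      (hcont.continuousAt hs0)).const_sub (F 1)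
    refine h.congr_of_eventuallyEq ?_
    filter_upwards [Ioi_mem_nhds hs] with t ht
    exact hF_eq t ht
  have hdf : DifferentiableOn ℝ (deriv f) (Ioi 0) :=
    (hf.deriv_of_isOpen (m := 1) isOpen_Ioi (by norm_num)).differentiableOn one_ne_zero
  have hinv_deriv : ∀ s : ℝ, 0 < s →
      HasDerivAt (fun t => (deriv f t)⁻¹) (-deriv (deriv f) s / deriv f s ^ 2) s := fun s hs =>
    ((hdf.differentiableAt (Ioi_mem_nhds hs)).hasDerivAt).fun_inv (hf'pos s hs).ne'
  have key : Tendsto (fun s => F s / (deriv f s)⁻¹) atTop (𝓝 q) := by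
    refine HasDerivAt.lhopital_zero_atTop (f' := fun s => -(f s)⁻¹)
      (g' := fun s => -deriv (deriv f) s / deriv f s ^ 2)
      ?_ ?_ ?_ hF_zero hf'top.inv_tendsto_atTop ?_
    · filter_upwards [eventually_gt_atTop 1] with s hs using hF_deriv s hs
    · filter_upwards [eventually_gt_atTop 0] with s hs using hinv_deriv s hs
    · filter_upwards [eventually_gt_atTop 0, hf''pos] with s hs h2
      exact div_ne_zero (neg_ne_zero.2 h2.ne') (pow_ne_zero 2 (hf'pos s hs).ne')
    · refine hq.congr' ?_
      filter_upwards [eventually_gt_atTop 0, hf''pos] with s hs h2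
      have h0 := (hfpos s hs).ne'
      have h1 := (hf'pos s hs).ne'
      have h2 := h2.ne'
      field_simp
  refine key.congr fun s => ?_
  rw [div_inv_eq_mul, mul_comm]
end

section
/- Let p > 1 and 1 < r < p. Then for every s > 1 the series Σ_{k=0}^{∞} (−1)^k · s^{1−p−k(p−r)} / (p + k(p−r) − 1) converges and F(s) = Σ_{k=0}^{∞} (−1)^k · s^{1−p−k(p−r)} / (p + k(p−r) − 1), where F(s) := ∫_s^∞ dt/(t^p + t^r). -/
open MeasureTheory in
/-- Termwise integration over `(s, ∞)` of the geometric expansion of `(t ^ p + t ^ r)⁻¹`. -/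
theorem hasSum_integral_Ioi_inv_rpow_add_rpow {p r s : ℝ} (hp : 1 < p) (hrp : r < p)
    (hs : 1 < s) :
    HasSum (fun k : ℕ => (-1 : ℝ) ^ k * s ^ (1 - p - (k : ℝ) * (p - r)) /
        (p + (k : ℝ) * (p - r) - 1))
      (∫ t in Set.Ioi s, (t ^ p + t ^ r)⁻¹) := by
  have hs0 : 0 < s := by linarith
  have hq1 : s ^ (r - p) < 1 := Real.rpow_lt_one_of_one_lt_of_neg hs (by linarith)
  have hq0 : 0 ≤ s ^ (r - p) := by positivity
  have hexp (k : ℕ) : -p - (k : ℝ) * (p - r) < -1 := by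
    have : 0 ≤ (k : ℝ) * (p - r) := mul_nonneg k.cast_nonneg (by linarith)
    linarith
  have hterm {t : ℝ} (ht : 0 < t) (k : ℕ) :
      (-1 : ℝ) ^ k * t ^ (-p - (k : ℝ) * (p - r)) = t ^ (-p) * (-t ^ (r - p)) ^ k := by
    rw [show -p - (k : ℝ) * (p - r) = -p + (r - p) * k by ring, Real.rpow_add ht,
      Real.rpow_mul_natCast ht.le, neg_pow (t ^ (r - p))]
    ring
  have hsum : HasSum
      (fun k : ℕ => ∫ t in Set.Ioi s, (-1 : ℝ) ^ k * t ^ (-p - (k : ℝ) * (p - r)))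
      (∫ t in Set.Ioi s, (t ^ p + t ^ r)⁻¹) := by
    refine hasSum_integral_of_dominated_convergence
      (fun k t => t ^ (-p) * (s ^ (r - p)) ^ k) (fun k => ?_) (fun k => ?_) ?_ ?_ ?_
    · exact ((integrableOn_Ioi_rpow_of_lt (hexp k) hs0).const_mul _).aestronglyMeasurable
    · filter_upwards [ae_restrict_mem measurableSet_Ioi] with t (ht : s < t)
      have ht0 : 0 < t := hs0.trans ht
      rw [hterm ht0, norm_mul, norm_pow, norm_neg, Real.norm_of_nonneg (by positivity),
        Real.norm_of_nonneg (by positivity)]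
      gcongr ?_ * ?_ ^ k
      exact Real.rpow_le_rpow_of_nonpos hs0 ht.le (by linarith)
    · exact ae_of_all _ fun t => (summable_geometric_of_lt_one hq0 hq1).mul_left _
    · simp_rw [tsum_mul_left]
      exact (integrableOn_Ioi_rpow_of_lt (by linarith) hs0).mul_const _
    · filter_upwards [ae_restrict_mem measurableSet_Ioi] with t (ht : s < t)
      have ht0 : 0 < t := hs0.trans ht
      have hlt : |-t ^ (r - p)| < 1 := by
        rw [abs_neg, abs_of_nonneg (by positivity)]
        exact Real.rpow_lt_one_of_one_lt_of_neg (hs.trans ht) (by linarith)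
      have hinv : (t ^ p + t ^ r)⁻¹ = t ^ (-p) * (1 - -t ^ (r - p))⁻¹ := by
        rw [Real.rpow_neg ht0.le, ← mul_inv, sub_neg_eq_add, mul_add, mul_one,
          ← Real.rpow_add ht0, add_sub_cancel]
      simp_rw [hterm ht0, hinv]
      exact (hasSum_geometric_of_abs_lt_one hlt).mul_left _
  convert hsum using 2 with k
  rw [integral_const_mul, integral_Ioi_rpow_of_lt (hexp k) hs0, mul_div_assoc, neg_div,
    ← div_neg]
  congr 3 <;> ring


/-- for `f(s) = s^p + s^r` with `p > 1`, `1 < r < p`, and every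
`s > 1`, the series `Σ_{k=0}^{∞} (−1)^k s^{1−p−k(p−r)}/(p+k(p−r)−1)` converges
and equals `F(s) = ∫_s^∞ dt/(t^p + t^r)`. -/
theorem F_series_expansion (p r : ℝ) (hp : 1 < p) (hr : 1 < r) (hrp : r < p)
    (F : ℝ → ℝ)
    (hF : ∀ s : ℝ, F s = ∫ t in Set.Ioi s, (t ^ p + t ^ r)⁻¹) :
    ∀ s : ℝ, 1 < s →
      Summable (fun k : ℕ =>
        (-1 : ℝ) ^ k * s ^ (1 - p - (k : ℝ) * (p - r)) /
          (p + (k : ℝ) * (p - r) - 1)) ∧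
      F s = ∑' k : ℕ,
        (-1 : ℝ) ^ k * s ^ (1 - p - (k : ℝ) * (p - r)) /
          (p + (k : ℝ) * (p - r) - 1) := by
  intro s hs
  have h := hasSum_integral_Ioi_inv_rpow_add_rpow hp hrp hs
  exact ⟨h.summable, (hF s).trans h.tsum_eq.symm⟩
end
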